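/- Let H be a real inner product space with dim H ≥ d+1, v₁,…,v_{d+1} ∈ H, and u ∈ H∖{0}. Define |g_d sin₀(w₁,…,w_{d+1})| = |M_{d+1}(w₁,…,w_{d+1})| / (∏_{j=1}^{d+1} |M_d(w₁,…,w_{j−1},w_{j+1},…,w_{d+1})|)^{1/d}, with value 0 when the denominator vanishes, where |M_k| is the square root of the Gram determinant. Then |g_d sin₀(v₁,…,v_{d+1})| ≤ Σ_{i=1}^{d+1} |g_d sin₀(v₁,…,v_{i−1},u,v_{i+1},…,v_{d+1})|. -/

import Mathlib

open scoped RealInnerProductSpace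

/-- The `k`-dimensional content: the square root of the Gram determinant. -/
noncomputable def gramContent {H : Type*} [NormedAddCommGroup H] [InnerProductSpace ℝ H]
    {k : ℕ} (v : Fin k → H) : ℝ :=
  Real.sqrt (Matrix.det (Matrix.of fun i j => ⟪v i, v j⟫))

/-- The `d`-dimensional hypersine root `|g_d sin₀|`: the `(d+1)`-content divided by
the product of the `d`-th roots of the `d`-contents of the faces through `0`
(zero if the denominator vanishes, since `x / 0 = 0`). -/
noncomputable def hyperSin {H : Type*} [NormedAddCommGroup H] [InnerProductSpace ℝ H]
    {d : ℕ} (v : Fin (d + 1) → H) : ℝ :=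
  gramContent v /
    (∏ j : Fin (d + 1), gramContent fun i : Fin d => v (j.succAbove i)) ^ ((1 : ℝ) / d)

open Matrix

section Content

variable {H : Type*} [NormedAddCommGroup H] [InnerProductSpace ℝ H]

/-- The content of a finite family of vectors indexed by an arbitrary finite type. -/
noncomputable def familyContent {ι : Type*} [Fintype ι] [DecidableEq ι] (w : ι → H) : ℝ :=
  √(gram ℝ w).det

theorem familyContent_nonneg {ι : Type*} [Fintype ι] [DecidableEq ι] (w : ι → H) :
    0 ≤ familyContent w :=
  Real.sqrt_nonneg _

theorem gramContent_eq_familyContent {k : ℕ} (v : Fin k → H) :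
    gramContent v = familyContent v :=
  rfl

theorem familyContent_comp_equiv {ι κ : Type*} [Fintype ι] [DecidableEq ι] [Fintype κ]
    [DecidableEq κ] (e : ι ≃ κ) (w : κ → H) : familyContent (w ∘ e) = familyContent w := by
  unfold familyContent
  rw [show gram ℝ (w ∘ e) = (gram ℝ w).submatrix e e from rfl, det_submatrix_equiv_self]

theorem familyContent_ne_zero_iff {ι : Type*} [Fintype ι] [DecidableEq ι] {w : ι → H} :
    familyContent w ≠ 0 ↔ LinearIndependent ℝ w := by
  rw [familyContent, Real.sqrt_ne_zero (posSemidef_gram ℝ w).det_nonneg,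
    det_gram_ne_zero_iff_linearIndependent]

theorem familyContent_pos_iff {ι : Type*} [Fintype ι] [DecidableEq ι] {w : ι → H} :
    0 < familyContent w ↔ LinearIndependent ℝ w := by
  rw [← familyContent_ne_zero_iff, (familyContent_nonneg w).lt_iff_ne']

/-- The vector `x` minus its orthogonal projection onto the span of the independent family `e`. -/
noncomputable def gramResidual {ι : Type*} [Fintype ι] [DecidableEq ι] (e : ι → H) (x : H) :
    H :=
  x - ∑ k, ((gram ℝ e)⁻¹ *ᵥ fun l => ⟪e l, x⟫) k • e k

theorem inner_residual {ι : Type*} [Fintype ι] [DecidableEq ι] {e : ι → H}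
    (he : LinearIndependent ℝ e) (k : ι) (x : H) : ⟪e k, gramResidual e x⟫ = 0 := by
  have hdet : IsUnit (gram ℝ e).det := (det_gram_ne_zero_iff_linearIndependent.2 he).isUnit
  have h := congrFun (mulVec_mulVec (fun l => ⟪e l, x⟫) (gram ℝ e) (gram ℝ e)⁻¹) k
  rw [mul_nonsing_inv _ hdet, one_mulVec] at h
  rw [gramResidual, inner_sub_right, inner_sum, ← h, sub_eq_zero, mulVec, dotProduct]
  exact Finset.sum_congr rfl fun l _ => by rw [inner_smul_right, gram_apply, mul_comm]

theorem inner_residual_residual {ι : Type*} [Fintype ι] [DecidableEq ι] {e : ι → H}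
    (he : LinearIndependent ℝ e) (x y : H) :
    ⟪gramResidual e x, gramResidual e y⟫ = ⟪x, gramResidual e y⟫ := by
  conv_lhs => rw [gramResidual, inner_sub_left, sum_inner]
  simp [inner_smul_left, inner_residual he]

theorem familyContent_sumElim {ι κ : Type*} [Fintype ι] [DecidableEq ι] [Fintype κ]
    [DecidableEq κ] {e : ι → H} (he : LinearIndependent ℝ e) (f : κ → H) :
    familyContent (Sum.elim e f) = familyContent e * familyContent (gramResidual e ∘ f) := by
  have hdet : IsUnit (gram ℝ e).det := (det_gram_ne_zero_iff_linearIndependent.2 he).isUnit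
  let _ := invertibleOfIsUnitDet _ hdet
  have hblocks : gram ℝ (Sum.elim e f) = fromBlocks (gram ℝ e) (of fun i j => ⟪e i, f j⟫)
      (of fun i j => ⟪f i, e j⟫) (gram ℝ f) := by
    ext (i | i) (j | j) <;> rfl
  have hschur : gram ℝ f - (of fun i j => ⟪f i, e j⟫) * ⅟(gram ℝ e) *
      (of fun i j => ⟪e i, f j⟫) = gram ℝ (gramResidual e ∘ f) := by
    ext i j
    rw [gram_apply, Function.comp_apply, Function.comp_apply, inner_residual_residual he,
      gramResidual, inner_sub_right, inner_sum, Matrix.mul_assoc, invOf_eq_nonsing_inv, Matrix.sub_apply,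
      gram_apply, mul_apply]
    congr 1
    refine Finset.sum_congr rfl fun k _ => ?_
    rw [inner_smul_right, mul_comm]
    rfl
  rw [familyContent, hblocks, det_fromBlocks₁₁, hschur,
    Real.sqrt_mul (posSemidef_gram ℝ e).det_nonneg]
  rfl

theorem familyContent_single (x : H) : familyContent ![x] = ‖x‖ := by
  simp [familyContent]

theorem familyContent_pair (x y : H) :
    familyContent ![x, y] = √(⟪x, x⟫ * ⟪y, y⟫ - ⟪x, y⟫ ^ 2) := by
  rw [familyContent, det_fin_two]
  simp only [gram_apply, cons_val_zero, cons_val_one]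
  rw [real_inner_comm x y, sq]

/-- The triangle inequality for the sine of the angle between two vectors, in homogeneous form. -/
theorem norm_mul_familyContent_pair_le (x y u : H) :
    ‖u‖ * familyContent ![x, y] ≤
      ‖x‖ * familyContent ![u, y] + ‖y‖ * familyContent ![x, u] := by
  have cs (a b : H) : 0 ≤ ⟪a, a⟫ * ⟪b, b⟫ - ⟪a, b⟫ ^ 2 := by
    have := real_inner_mul_inner_self_le a b
    nlinarith
  rcases eq_or_ne u 0 with rfl | hu
  · rw [norm_zero, zero_mul]
    exact add_nonneg (mul_nonneg (norm_nonneg _) (familyContent_nonneg _))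
      (mul_nonneg (norm_nonneg _) (familyContent_nonneg _))
  have hα : 0 < ‖u‖ ^ 2 := by positivity
  set α := ‖u‖ ^ 2 with hαdef
  have hX2 : familyContent ![x, u] ^ 2 = ‖x‖ ^ 2 * α - ⟪x, u⟫ ^ 2 := by
    rw [familyContent_pair, Real.sq_sqrt (cs _ _)]; simp [hαdef]
  have hY2 : familyContent ![u, y] ^ 2 = α * ‖y‖ ^ 2 - ⟪u, y⟫ ^ 2 := by
    rw [familyContent_pair, Real.sq_sqrt (cs _ _)]; simp [hαdef]
  have hM2 : familyContent ![x, y] ^ 2 = ‖x‖ ^ 2 * ‖y‖ ^ 2 - ⟪x, y⟫ ^ 2 := by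
    rw [familyContent_pair, Real.sq_sqrt (cs _ _)]; simp
  have hX := familyContent_nonneg ![x, u]
  have hY := familyContent_nonneg ![u, y]
  set X := familyContent ![x, u]
  set Y := familyContent ![u, y]
  set M := familyContent ![x, y]
  set a := ⟪x, u⟫
  set b := ⟪u, y⟫
  set c := ⟪x, y⟫
  have hab : |a * b| ≤ α * (‖x‖ * ‖y‖) := by
    rw [abs_mul]
    calc |a| * |b| ≤ (‖x‖ * ‖u‖) * (‖u‖ * ‖y‖) :=
          mul_le_mul (abs_real_inner_le_norm x u) (abs_real_inner_le_norm u y) (abs_nonneg _)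
            (by positivity)
      _ = α * (‖x‖ * ‖y‖) := by rw [hαdef]; ring
  -- the inner product of the components of `x` and `y` orthogonal to `u`, scaled by `α`
  have hZ : (α * c - a * b) ^ 2 ≤ (X * Y) ^ 2 := by
    have h := cs (α • x - a • u) (α • y - b • u)
    have e1 : ⟪α • x - a • u, α • x - a • u⟫ = α * X ^ 2 := by
      simp only [inner_sub_left, inner_sub_right, real_inner_smul_left, real_inner_smul_right,
        real_inner_comm x u, hX2]
      rw [real_inner_self_eq_norm_sq, real_inner_self_eq_norm_sq, ← hαdef]
      ring
    have e2 : ⟪α • y - b • u, α • y - b • u⟫ = α * Y ^ 2 := by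
      simp only [inner_sub_left, inner_sub_right, real_inner_smul_left, real_inner_smul_right,
        real_inner_comm u y, hY2]
      rw [real_inner_self_eq_norm_sq, real_inner_self_eq_norm_sq, ← hαdef]
      ring
    have e3 : ⟪α • x - a • u, α • y - b • u⟫ = α * (α * c - a * b) := by
      simp only [inner_sub_left, inner_sub_right, real_inner_smul_left, real_inner_smul_right,
        real_inner_self_eq_norm_sq, ← hαdef]
      ring
    rw [e1, e2, e3] at h
    have : 0 ≤ α ^ 2 * ((X * Y) ^ 2 - (α * c - a * b) ^ 2) := by linarith [h]
    linarith [nonneg_of_mul_nonneg_right this (by positivity)]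
  have hZ' : |α * c - a * b| ≤ X * Y := abs_le_of_sq_le_sq hZ (by positivity)
  have hcross : |(α * c - a * b) * (a * b)| ≤ X * Y * (α * (‖x‖ * ‖y‖)) := by
    rw [abs_mul]
    exact mul_le_mul hZ' hab (abs_nonneg _) (by positivity)
  refine le_of_sq_le_sq ?_ (by positivity)
  have key : α * (‖x‖ * Y + ‖y‖ * X) ^ 2 - α * (‖u‖ * M) ^ 2 =
      (X * Y) ^ 2 + (α * c - a * b) ^ 2 + 2 * ((α * c - a * b) * (a * b)) +
        2 * (X * Y * (α * (‖x‖ * ‖y‖))) := by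
    rw [mul_pow ‖u‖, ← hαdef, hM2]
    have : α * (‖x‖ * Y + ‖y‖ * X) ^ 2 =
        α * ‖x‖ ^ 2 * Y ^ 2 + α * ‖y‖ ^ 2 * X ^ 2 + 2 * (X * Y * (α * (‖x‖ * ‖y‖))) := by ring
    rw [this, mul_pow X, hX2, hY2]
    ring
  have := neg_abs_le ((α * c - a * b) * (a * b))
  have hle : 0 ≤ α * ((‖x‖ * Y + ‖y‖ * X) ^ 2 - (‖u‖ * M) ^ 2) := by
    nlinarith [sq_nonneg (X * Y), sq_nonneg (α * c - a * b)]
  linarith [nonneg_of_mul_nonneg_right hle hα]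

theorem familyContent_sumElim_mul_le {ι : Type*} [Fintype ι] [DecidableEq ι] {e : ι → H}
    (he : LinearIndependent ℝ e) (x y u : H) :
    familyContent (Sum.elim e ![u]) * familyContent (Sum.elim e ![x, y]) ≤
      familyContent (Sum.elim e ![x]) * familyContent (Sum.elim e ![u, y]) +
        familyContent (Sum.elim e ![y]) * familyContent (Sum.elim e ![x, u]) := by
  have h1 (a : H) : gramResidual e ∘ ![a] = ![gramResidual e a] := by ext i; fin_cases i; rfl
  have h2 (a b : H) : gramResidual e ∘ ![a, b] = ![gramResidual e a, gramResidual e b] := by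
    ext i; fin_cases i <;> rfl
  simp only [familyContent_sumElim he, h1, h2, familyContent_single]
  have := mul_le_mul_of_nonneg_left
    (norm_mul_familyContent_pair_le (gramResidual e x) (gramResidual e y) (gramResidual e u))
    (sq_nonneg (familyContent e))
  linarith

theorem gramContent_face_eq {d : ℕ} (w : Fin (d + 1) → H) (j : Fin (d + 1)) {κ : Type*}
    [Fintype κ] [DecidableEq κ] (σ : κ → Fin (d + 1)) (hσ : Function.Injective σ)
    (hrange : Set.range σ = {j}ᶜ) :
    gramContent (fun k : Fin d => w (j.succAbove k)) = familyContent (w ∘ σ) := by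
  let e : Fin d ≃ κ :=
    (Equiv.ofInjective _ Fin.succAbove_right_injective).trans
      ((Equiv.setCongr ((Fin.range_succAbove j).trans hrange.symm)).trans
        (Equiv.ofInjective σ hσ).symm)
  have he (k : Fin d) : σ (e k) = j.succAbove k := by
    simp [e, Equiv.apply_ofInjective_symm]
  rw [gramContent_eq_familyContent, ← familyContent_comp_equiv e]
  exact congrArg familyContent (funext fun k => by simp [he])

theorem gramContent_face_eq_sumElim {d : ℕ} (w : Fin (d + 1) → H) {i j : Fin (d + 1)}
    (hij : i ≠ j) {p : Fin (d + 1) → Prop} [DecidablePred p] (hp : ∀ k, p k ↔ k ≠ i ∧ k ≠ j) :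
    gramContent (fun k : Fin d => w (j.succAbove k)) =
      familyContent (Sum.elim (fun k : {k // p k} => w k) ![w i]) := by
  rw [gramContent_face_eq w j (Sum.elim (Subtype.val : {k // p k} → _) ![i])]
  · congr 1
    ext (k | k)
    · rfl
    · fin_cases k; rfl
  · refine Subtype.val_injective.sumElim (Function.injective_of_subsingleton _) fun k l => ?_
    fin_cases l
    exact ((hp k).1 k.2).1
  · ext k
    simp only [Set.Sum.elim_range, Set.mem_union, Set.mem_range (f := Subtype.val),
      Subtype.exists, exists_prop, exists_eq_right, hp, Matrix.range_cons, Matrix.range_empty,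
      Set.union_empty, Set.mem_singleton_iff, Set.mem_compl_iff]
    grind

theorem gramContent_face_update_mul_le {d : ℕ} {v : Fin (d + 1) → H}
    (hv : LinearIndependent ℝ v) (u : H) {i j : Fin (d + 1)} (hij : j ≠ i) :
    gramContent (fun k : Fin d => Function.update v i u (j.succAbove k)) * gramContent v ≤
      gramContent (Function.update v i u) * gramContent (fun k : Fin d => v (j.succAbove k)) +
        gramContent (Function.update v j u) *
          gramContent (fun k : Fin d => v (i.succAbove k)) := by
  let S := {k : Fin (d + 1) // k ≠ i ∧ k ≠ j}
  let e : S → H := fun k => v k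
  have he : LinearIndependent ℝ e := hv.comp _ Subtype.val_injective
  have hτ : Function.Bijective (Sum.elim (Subtype.val : S → _) ![i, j]) := by
    constructor
    · refine Subtype.val_injective.sumElim ?_ fun k l => ?_
      · intro a b h
        fin_cases a <;> fin_cases b <;> simp_all
      · fin_cases l
        exacts [k.2.1, k.2.2]
    · rw [← Set.range_eq_univ]
      ext k
      simp only [Set.Sum.elim_range, Set.mem_union, Set.mem_range (f := Subtype.val),
        Subtype.exists, exists_prop, exists_eq_right, Matrix.range_cons, Matrix.range_empty,
        Set.union_empty, Set.mem_singleton_iff, Set.mem_univ]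
      grind
  have full (w : Fin (d + 1) → H) :
      gramContent w = familyContent (Sum.elim (fun k : S => w k) ![w i, w j]) := by
    rw [gramContent_eq_familyContent, ← familyContent_comp_equiv (Equiv.ofBijective _ hτ)]
    congr 1
    ext (k | k)
    · rfl
    · fin_cases k <;> rfl
  have hei : (fun k : S => Function.update v i u k) = e :=
    funext fun k => Function.update_of_ne k.2.1 _ _
  have hej : (fun k : S => Function.update v j u k) = e :=
    funext fun k => Function.update_of_ne k.2.2 _ _
  rw [gramContent_face_eq_sumElim _ hij.symm (p := fun k => k ≠ i ∧ k ≠ j) fun _ => Iff.rfl,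
    gramContent_face_eq_sumElim v hij.symm (p := fun k => k ≠ i ∧ k ≠ j) fun _ => Iff.rfl,
    gramContent_face_eq_sumElim v hij (p := fun k => k ≠ i ∧ k ≠ j) fun _ => and_comm,
    full, full, full, hei, hej, Function.update_self, Function.update_self,
    Function.update_of_ne hij, Function.update_of_ne hij.symm]
  linarith [familyContent_sumElim_mul_le he (v i) (v j) u]

theorem mem_span_of_not_linearIndependent_update {ι : Type*} [DecidableEq ι] {v : ι → H}
    (hv : LinearIndependent ℝ v) {u : H} {i : ι}
    (h : ¬ LinearIndependent ℝ (Function.update v i u)) : u ∈ Submodule.span ℝ (v '' {i}ᶜ) := by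
  by_contra hu
  refine h ?_
  rw [← linearIndependent_equiv (Equiv.optionSubtypeNe i), linearIndependent_option]
  have hcomp : (Function.update v i u ∘ Equiv.optionSubtypeNe i) ∘
      ((↑) : {k // k ≠ i} → Option {k // k ≠ i}) = fun k : {k // k ≠ i} => v k := by
    ext ⟨k, hk⟩
    simp [hk]
  rw [hcomp]
  refine ⟨hv.comp _ Subtype.val_injective, ?_⟩
  rw [show Set.range (fun k : {k // k ≠ i} => v k) = v '' {i}ᶜ by
    ext x; simp]
  simpa using hu

theorem exists_linearIndependent_update {ι : Type*} [Nonempty ι] [DecidableEq ι]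
    {v : ι → H} (hv : LinearIndependent ℝ v) {u : H} (hu : u ≠ 0) :
    ∃ i, LinearIndependent ℝ (Function.update v i u) := by
  by_contra! h
  have hspan (i : ι) := (Finsupp.mem_span_image_iff_linearCombination ℝ).1
    (mem_span_of_not_linearIndependent_update hv (h i))
  choose l hl hlu using hspan
  obtain ⟨i₀⟩ := ‹Nonempty ι›
  have hzero : l i₀ = 0 := by
    ext i
    rw [hv ((hlu i₀).trans (hlu i).symm)]
    by_contra hne
    exact (Finsupp.mem_supported ℝ _).1 (hl i) (Finsupp.mem_support_iff.2 hne) rfl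
  exact hu (by rw [← hlu i₀, hzero, map_zero])

theorem hyperSin_nonneg {d : ℕ} (w : Fin (d + 1) → H) : 0 ≤ hyperSin w :=
  div_nonneg (Real.sqrt_nonneg _)
    (Real.rpow_nonneg (Finset.prod_nonneg fun _ _ => Real.sqrt_nonneg _) _)

/-- A bound on the face contents after replacing `v i` by `u` gives a lower bound for the
corresponding hypersine root in terms of that of `v`. -/
theorem div_mul_hyperSin_le {d : ℕ} (hd : 1 ≤ d) {v : Fin (d + 1) → H}
    (hv : LinearIndependent ℝ v) (u : H) (i : Fin (d + 1)) {S : ℝ} (hS : 0 < S)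
    (hface : ∀ j, j ≠ i →
      gramContent (fun k : Fin d => Function.update v i u (j.succAbove k)) * gramContent v ≤
        gramContent (fun k : Fin d => v (i.succAbove k)) *
          gramContent (fun k : Fin d => v (j.succAbove k)) * S) :
    gramContent (Function.update v i u) / gramContent (fun k : Fin d => v (i.succAbove k)) / S *
      hyperSin v ≤ hyperSin (Function.update v i u) := by
  set F : Fin (d + 1) → ℝ := fun j => gramContent fun k : Fin d => v (j.succAbove k) with hF
  set G : Fin (d + 1) → ℝ :=
    fun j => gramContent fun k : Fin d => Function.update v i u (j.succAbove k) with hG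
  have hFpos (j) : 0 < F j :=
    familyContent_pos_iff.2 (hv.comp _ Fin.succAbove_right_injective)
  have hM : 0 < gramContent v := familyContent_pos_iff.2 hv
  have hGi : G i = F i := by simp [hF, hG, Function.update_of_ne]
  by_cases hw : LinearIndependent ℝ (Function.update v i u)
  swap
  · have : gramContent (Function.update v i u) = 0 :=
      of_not_not (mt familyContent_ne_zero_iff.1 hw)
    rw [this, zero_div, zero_div, zero_mul]
    exact hyperSin_nonneg _
  have hA : 0 < gramContent (Function.update v i u) := familyContent_pos_iff.2 hw
  have hGpos (j) : 0 < G j :=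
    familyContent_pos_iff.2 (hw.comp _ Fin.succAbove_right_injective)
  have hP : 0 < ∏ j, F j := Finset.prod_pos fun j _ => hFpos j
  have hprod : ∏ j, G j ≤ (F i * S / gramContent v) ^ d * ∏ j, F j := by
    rw [Fin.prod_univ_succAbove _ i, Fin.prod_univ_succAbove F i, hGi]
    have hle : ∏ k, G (i.succAbove k) ≤
        ∏ k : Fin d, (F i * S / gramContent v * F (i.succAbove k)) := by
      refine Finset.prod_le_prod (fun k _ => (hGpos _).le) fun k _ => ?_
      rw [div_mul_eq_mul_div, le_div_iff₀ hM]
      linarith [hface _ (Fin.succAbove_ne i k)]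
    rw [Finset.prod_mul_distrib, Finset.prod_const, Finset.card_univ, Fintype.card_fin] at hle
    calc F i * ∏ k, G (i.succAbove k)
        ≤ F i * ((F i * S / gramContent v) ^ d * ∏ k, F (i.succAbove k)) :=
          mul_le_mul_of_nonneg_left hle (hFpos i).le
      _ = _ := by ring
  have hroot : (∏ j, G j) ^ ((1 : ℝ) / d) ≤
      F i * S / gramContent v * (∏ j, F j) ^ ((1 : ℝ) / d) := by
    have hq : 0 ≤ F i * S / gramContent v := by have := hFpos i; positivity
    calc (∏ j, G j) ^ ((1 : ℝ) / d)
        ≤ ((F i * S / gramContent v) ^ d * ∏ j, F j) ^ ((1 : ℝ) / d) :=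
          Real.rpow_le_rpow (Finset.prod_nonneg fun j _ => (hGpos j).le) hprod (by positivity)
      _ = _ := by
          rw [Real.mul_rpow (by positivity) hP.le, one_div,
            Real.pow_rpow_inv_natCast hq (by omega)]
  have hGroot : 0 < (∏ j, G j) ^ ((1 : ℝ) / d) :=
    Real.rpow_pos_of_pos (Finset.prod_pos fun j _ => hGpos j) _
  have hFroot : 0 < (∏ j, F j) ^ ((1 : ℝ) / d) := Real.rpow_pos_of_pos hP _
  calc gramContent (Function.update v i u) / F i / S * hyperSin v
      = gramContent (Function.update v i u) /
          (F i * S / gramContent v * (∏ j, F j) ^ ((1 : ℝ) / d)) := by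
        rw [show hyperSin v = gramContent v / (∏ j, F j) ^ ((1 : ℝ) / d) from rfl]
        have := (hFpos i).ne'
        field_simp
    _ ≤ gramContent (Function.update v i u) / (∏ j, G j) ^ ((1 : ℝ) / d) :=
        div_le_div_of_nonneg_left hA.le hGroot hroot

end Content

theorem hyperSin_simplex_inequality {H : Type*} [NormedAddCommGroup H]
    [InnerProductSpace ℝ H] {d : ℕ} (hd : 1 ≤ d)
    (hdim : (d + 1 : Cardinal) ≤ Module.rank ℝ H)
    (v : Fin (d + 1) → H) (u : H) (hu : u ≠ 0) :
    hyperSin v ≤ ∑ i, hyperSin (Function.update v i u) := by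
  by_cases hv : LinearIndependent ℝ v
  swap
  · have hzero : gramContent v = 0 := of_not_not (mt familyContent_ne_zero_iff.1 hv)
    rw [hyperSin, hzero, zero_div]
    exact Finset.sum_nonneg fun i _ => hyperSin_nonneg _
  set F : Fin (d + 1) → ℝ := fun j => gramContent fun k : Fin d => v (j.succAbove k) with hF
  set B : Fin (d + 1) → ℝ := fun j => gramContent (Function.update v j u) / F j with hB
  have hFpos (j) : 0 < F j :=
    familyContent_pos_iff.2 (hv.comp _ Fin.succAbove_right_injective)
  have hBnonneg (j) : 0 ≤ B j := div_nonneg (Real.sqrt_nonneg _) (hFpos j).le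
  have hBF (j) : gramContent (Function.update v j u) = B j * F j :=
    (div_mul_cancel₀ _ (hFpos j).ne').symm
  have hS : 0 < ∑ j, B j := by
    obtain ⟨i, hi⟩ := exists_linearIndependent_update hv hu
    exact Finset.sum_pos' (fun j _ => hBnonneg j)
      ⟨i, Finset.mem_univ i, div_pos (familyContent_pos_iff.2 hi) (hFpos i)⟩
  have hterm (i) : B i / (∑ j, B j) * hyperSin v ≤ hyperSin (Function.update v i u) := by
    refine div_mul_hyperSin_le hd hv u i hS fun j hji => ?_
    refine (gramContent_face_update_mul_le hv u hji).trans ?_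
    have hpair : B i + B j ≤ ∑ k, B k := by
      rw [← Finset.sum_pair hji.symm]
      exact Finset.sum_le_sum_of_subset_of_nonneg (Finset.subset_univ _)
        fun k _ _ => hBnonneg k
    have := mul_le_mul_of_nonneg_left hpair (mul_pos (hFpos i) (hFpos j)).le
    rw [hBF i, hBF j]
    change B i * F i * F j + B j * F j * F i ≤ F i * F j * ∑ k, B k
    linarith
  calc hyperSin v = ∑ i, B i / (∑ j, B j) * hyperSin v := by
        rw [← Finset.sum_mul, ← Finset.sum_div, div_self hS.ne', one_mul]
    _ ≤ _ := Finset.sum_le_sum fun i _ => hterm i
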